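/- There exists a constant C > 0 such that for every n, every k with 1 ≤ k ≤ n − 1, and every set S of n line segments in the plane ℝ²: the number of open quadrants Q that touch two distinct segments of S (i.e. Q ∩ s₁ = Q ∩ s₂ = ∅ but the closure of Q meets both s₁ and s₂) and that intersect at least k − 1 segments of S, is at most C·n·(n − k); moreover, if the segments of S are pairwise disjoint, this number is at most C·(n − k)². (These quadrants are the supporting quadrants counting the unbounded Voronoi edges of orders ≥ k in the L∞ metric: Σ_{i=k}^{n−1} U_i = O(n(n−k)) in general, and O((n−k)²) for disjoint segments.) -/

import Mathlib

open Metric Set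
open scoped Classical

noncomputable section

abbrev Pt2 : Type := ℝ × ℝ
abbrev Seg2 : Type := Pt2 × Pt2

/-- The point set of a line segment given by its endpoints. -/
def segPts (s : Seg2) : Set Pt2 := segment ℝ s.1 s.2

/-- Every segment is nondegenerate (distinct endpoints). -/
def Nondeg (S : Finset Seg2) : Prop := ∀ s ∈ S, s.1 ≠ s.2

/-- The segments of `S` are pairwise disjoint. -/
def PwDisj (S : Finset Seg2) : Prop :=
  ∀ p ∈ S, ∀ q ∈ S, p ≠ q → Disjoint (segPts p) (segPts q)

/-- `Q` is an open quadrant: the intersection of two open halfplanes bounded by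
axis-parallel perpendicular lines. -/
def IsOpenQuadrant (Q : Set Pt2) : Prop :=
  ∃ a b : ℝ,
    Q = {z : Pt2 | a < z.1 ∧ b < z.2} ∨ Q = {z : Pt2 | a < z.1 ∧ z.2 < b} ∨
    Q = {z : Pt2 | z.1 < a ∧ b < z.2} ∨ Q = {z : Pt2 | z.1 < a ∧ z.2 < b}

/-- `Q` touches the segment `s`: `Q` misses `s` but its closure meets `s`. -/
def Touches (Q : Set Pt2) (s : Seg2) : Prop :=
  Q ∩ segPts s = ∅ ∧ (closure Q ∩ segPts s).Nonempty

/-- The supporting quadrants of `S` intersecting at least `k - 1` segments. -/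
def suppQuadrants (S : Finset Seg2) (k : ℕ) : Set (Set Pt2) :=
  {Q : Set Pt2 | IsOpenQuadrant Q ∧
    (∃ s₁ ∈ S, ∃ s₂ ∈ S, s₁ ≠ s₂ ∧ Touches Q s₁ ∧ Touches Q s₂) ∧
    k - 1 ≤ {t ∈ (S : Set Seg2) | (Q ∩ segPts t).Nonempty}.ncard}

/-- `p` is strictly dominated in both coordinates by some point of the segment `s`, that is, the
upper right open quadrant with corner `p` meets `s`. -/
def StrictlyBelow (p : Pt2) (s : Seg2) : Prop :=
  ∃ z ∈ segPts s, p.1 < z.1 ∧ p.2 < z.2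

/-- `p` is dominated by some point of `s`. -/
def WeaklyBelow (p : Pt2) (s : Seg2) : Prop :=
  ∃ z ∈ segPts s, p.1 ≤ z.1 ∧ p.2 ≤ z.2

/-- The upper right open quadrant with corner `p` touches `s`. -/
def OnStaircase (p : Pt2) (s : Seg2) : Prop :=
  ¬ StrictlyBelow p s ∧ WeaklyBelow p s

section Convexity

variable {s : Seg2} {p q : Pt2}

theorem StrictlyBelow.weaklyBelow (h : StrictlyBelow p s) : WeaklyBelow p s := by
  obtain ⟨z, hz, h1, h2⟩ := h
  exact ⟨z, hz, h1.le, h2.le⟩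

theorem WeaklyBelow.combo (hp : WeaklyBelow p s) (hq : WeaklyBelow q s) {a b : ℝ}
    (ha : 0 ≤ a) (hb : 0 ≤ b) (hab : a + b = 1) : WeaklyBelow (a • p + b • q) s := by
  obtain ⟨z, hz, hz1, hz2⟩ := hp
  obtain ⟨w, hw, hw1, hw2⟩ := hq
  refine ⟨a • z + b • w, convex_segment _ _ hz hw ha hb hab, ?_, ?_⟩ <;>
  · simp only [Prod.fst_add, Prod.snd_add, Prod.smul_fst, Prod.smul_snd, smul_eq_mul]
    gcongr

theorem WeaklyBelow.combo_strictlyBelow (hp : WeaklyBelow p s) (hq : StrictlyBelow q s)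
    {a b : ℝ} (ha : 0 ≤ a) (hb : 0 < b) (hab : a + b = 1) :
    StrictlyBelow (a • p + b • q) s := by
  obtain ⟨z, hz, hz1, hz2⟩ := hp
  obtain ⟨w, hw, hw1, hw2⟩ := hq
  refine ⟨a • z + b • w, convex_segment _ _ hz hw ha hb.le hab, ?_, ?_⟩ <;>
  · simp only [Prod.fst_add, Prod.snd_add, Prod.smul_fst, Prod.smul_snd, smul_eq_mul]
    refine add_lt_add_of_le_of_lt ?_ ?_ <;> gcongr

theorem isOpen_strictlyBelow (s : Seg2) : IsOpen {p | StrictlyBelow p s} := by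
  have : {p : Pt2 | StrictlyBelow p s} = ⋃ z ∈ segPts s, Iio z.1 ×ˢ Iio z.2 := by
    ext p; simp only [StrictlyBelow, mem_ofPred_eq, mem_iUnion, mem_prod, mem_Iio, exists_prop]
  rw [this]
  exact isOpen_biUnion fun z _ => isOpen_Iio.prod isOpen_Iio

end Convexity

section Counting

variable {ι : Type*}

/-- The indices of the segments that the upper right open quadrant with corner `p` avoids. -/
def avoided (f : ι → Seg2) (T : Finset ι) (p : Pt2) : Finset ι :=
  {i ∈ T | ¬ StrictlyBelow p (f i)}

/-- The corners of the upper right open quadrants that touch two segments of the family and avoid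
at most `m` of them. -/
def shallowVertices (f : ι → Seg2) (T : Finset ι) (m : ℕ) : Set Pt2 :=
  {p | (∃ i ∈ T, ∃ j ∈ T, i ≠ j ∧ OnStaircase p (f i) ∧ OnStaircase p (f j)) ∧
    (avoided f T p).card ≤ m}

/-- The shallow vertices on a part `E` of the staircase of the segment `f i`. -/
def verticesOn (f : ι → Seg2) (T : Finset ι) (m : ℕ) (i : ι) (E : Set Pt2) : Set Pt2 :=
  {p | p ∈ E ∧ (∃ j ∈ T, i ≠ j ∧ OnStaircase p (f j)) ∧ (avoided f T p).card ≤ m}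

variable {f : ι → Seg2} {T : Finset ι} {m : ℕ}

theorem infinite_shallowVertices {i j : ι} (hi : i ∈ T) (hj : j ∈ T) (hij : i ≠ j) {p q : Pt2}
    (hpq : p ≠ q) (hp : (avoided f T p).card ≤ m)
    (hseg : ∀ a b : ℝ, 0 ≤ a → 0 ≤ b → a + b = 1 →
      OnStaircase (a • p + b • q) (f i) ∧ OnStaircase (a • p + b • q) (f j)) :
    (shallowVertices f T m).Infinite := by
  set φ : ℝ → Pt2 := fun t => (1 - t) • p + t • q with hφ
  have hcont : Continuous φ := by fun_prop
  have hev : ∀ᶠ t in nhds (0 : ℝ), ∀ l ∈ T, StrictlyBelow p (f l) → StrictlyBelow (φ t) (f l) := by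
    rw [Filter.eventually_all_finset]
    intro l _
    by_cases hl : StrictlyBelow p (f l)
    · have h0 : φ 0 ∈ {p | StrictlyBelow p (f l)} := by simpa [hφ] using hl
      filter_upwards [hcont.continuousAt.eventually_mem
        ((isOpen_strictlyBelow (f l)).mem_nhds h0)] with t ht _ using ht
    · simp [hl]
  have hev' := (hev.filter_mono (nhdsWithin_le_nhds (s := Ioi 0))).and
    (Ioo_mem_nhdsGT (zero_lt_one' ℝ))
  obtain ⟨ε, hε, hsub⟩ := mem_nhdsGT_iff_exists_Ioo_subset.1 hev'
  have hinj : Function.Injective φ := by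
    intro s t hst
    by_contra hne
    have h0 : (s - t) • (q - p) = 0 := by
      have : φ s - φ t = 0 := sub_eq_zero.2 hst
      rw [← this, hφ]; module
    rcases smul_eq_zero.1 h0 with h | h
    · exact hne (sub_eq_zero.1 h)
    · exact hpq (sub_eq_zero.1 h).symm
  refine ((Ioo_infinite hε).image hinj.injOn).mono ?_
  rintro _ ⟨t, ht, rfl⟩
  obtain ⟨h1, h2⟩ := hsub ht
  have := hseg (1 - t) t (by linarith [h2.2]) h2.1.le (by ring)
  refine ⟨⟨i, hi, j, hj, hij, this.1, this.2⟩, le_trans (Finset.card_le_card ?_) hp⟩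
  intro l hl
  simp only [avoided, Finset.mem_filter] at hl ⊢
  exact ⟨hl.1, fun h => hl.2 (h1 l hl.1 h)⟩

/-- On a line, the vertices that lie on one side of the region below a second segment are
few: this region is an interval, so the extreme vertex avoids all these segments. -/
theorem ncard_one_sided_le (hfin : (shallowVertices f T m).Finite) {i : ι} (hi : i ∈ T)
    {E : Set Pt2} (hE : Convex ℝ E) (hES : ∀ p ∈ E, OnStaircase p (f i)) (g : Pt2 →ₗ[ℝ] ℝ)
    (hg : InjOn g E) :
    {p | p ∈ E ∧ (∃ j ∈ T, i ≠ j ∧ OnStaircase p (f j) ∧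
      ∀ q ∈ E, StrictlyBelow q (f j) → g p < g q) ∧ (avoided f T p).card ≤ m}.ncard ≤ m := by
  set L := {p | p ∈ E ∧ (∃ j ∈ T, i ≠ j ∧ OnStaircase p (f j) ∧
      ∀ q ∈ E, StrictlyBelow q (f j) → g p < g q) ∧ (avoided f T p).card ≤ m} with hL
  have hLfin : L.Finite := hfin.subset fun p ⟨hpE, ⟨j, hj, hij, hpj, _⟩, hpm⟩ =>
    ⟨⟨i, hi, j, hj, hij, hES p hpE, hpj⟩, hpm⟩
  rcases L.eq_empty_or_nonempty with h0 | hne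
  · simp [h0]
  obtain ⟨p₀, hp₀, hmin⟩ := L.exists_min_image g hLfin hne
  have hch : ∀ p : Pt2, ∃ j : ι, p ∈ L → j ∈ T ∧ i ≠ j ∧ OnStaircase p (f j) ∧
      ∀ q ∈ E, StrictlyBelow q (f j) → g p < g q := by
    intro p
    by_cases hp : p ∈ L
    · obtain ⟨j, hj⟩ := hp.2.1
      exact ⟨j, fun _ => hj⟩
    · exact ⟨i, fun h => absurd h hp⟩
  choose t ht using hch
  have key : ∀ p ∈ L, ∀ q ∈ L, t p = t q → ¬ g p < g q := by
    intro p hp q hq hpq hlt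
    obtain ⟨hjT, hij, hpj, -⟩ := ht p hp
    obtain ⟨-, -, hqj, hqr⟩ := ht q hq
    rw [← hpq] at hqj hqr
    by_cases hex : ∃ r ∈ E, StrictlyBelow r (f (t p))
    · obtain ⟨r, hrE, hr⟩ := hex
      have hqr' := hqr r hrE hr
      have hd : 0 < g r - g p := by linarith
      set b := (g q - g p) / (g r - g p) with hb
      have hb0 : 0 < b := div_pos (by linarith) hd
      have hb1 : b ≤ 1 := (div_le_one hd).2 (by linarith)
      have hmem : (1 - b) • p + b • r ∈ E :=
        hE hp.1 hrE (by linarith) hb0.le (by ring)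
      have heq : (1 - b) • p + b • r = q := by
        apply hg hmem hq.1
        simp only [map_add, map_smul, smul_eq_mul]
        have : b * (g r - g p) = g q - g p := div_mul_cancel₀ _ hd.ne'
        linarith
      exact hqj.1 (heq ▸ hpj.2.combo_strictlyBelow hr (by linarith) hb0 (by ring))
    · push Not at hex
      refine infinite_shallowVertices hi hjT hij (p := p) (q := q) ?_ hp.2.2 ?_ hfin
      · rintro rfl; exact lt_irrefl _ hlt
      · intro a b ha hb hab
        have hmem := hE hp.1 hq.1 ha hb hab
        exact ⟨hES _ hmem, hex _ hmem, hpj.2.combo hqj.2 ha hb hab⟩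
  have hinj : InjOn t L := by
    intro p hp q hq hpq
    apply hg hp.1 hq.1
    exact le_antisymm (not_lt.1 (key q hq p hp hpq.symm)) (not_lt.1 (key p hp q hq hpq))
  have hmaps : ∀ p ∈ L, t p ∈ (avoided f T p₀ : Set ι) := by
    intro p hp
    obtain ⟨hjT, -, -, hpr⟩ := ht p hp
    simp only [avoided, Finset.coe_filter, mem_ofPred_eq]
    exact ⟨hjT, fun h => absurd (hpr p₀ hp₀.1 h) (not_lt.2 (hmin p hp))⟩
  calc L.ncard ≤ (avoided f T p₀ : Set ι).ncard :=
        ncard_le_ncard_of_injOn t hmaps hinj (Finset.finite_toSet _)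
    _ = (avoided f T p₀).card := ncard_coe_finset _
    _ ≤ m := hp₀.2.2

theorem finite_verticesOn (hfin : (shallowVertices f T m).Finite) {i : ι} (hi : i ∈ T)
    {E : Set Pt2} (hES : ∀ p ∈ E, OnStaircase p (f i)) : (verticesOn f T m i E).Finite :=
  hfin.subset fun p ⟨hpE, ⟨j, hj, hij, hpj⟩, hpm⟩ =>
    ⟨⟨i, hi, j, hj, hij, hES p hpE, hpj⟩, hpm⟩

theorem ncard_verticesOn_le (hfin : (shallowVertices f T m).Finite) {i : ι} (hi : i ∈ T)
    {E : Set Pt2} (hE : Convex ℝ E) (hES : ∀ p ∈ E, OnStaircase p (f i)) (g : Pt2 →ₗ[ℝ] ℝ)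
    (hg : InjOn g E) : (verticesOn f T m i E).ncard ≤ 2 * m := by
  have hneg : InjOn (-g) E := fun p hp q hq h => hg hp hq (by simpa using h)
  have h1 := ncard_one_sided_le hfin hi hE hES g hg
  have h2 := ncard_one_sided_le hfin hi hE hES (-g) hneg
  have hunion := ncard_union_le
    {p | p ∈ E ∧ (∃ j ∈ T, i ≠ j ∧ OnStaircase p (f j) ∧
      ∀ q ∈ E, StrictlyBelow q (f j) → g p < g q) ∧ (avoided f T p).card ≤ m}
    {p | p ∈ E ∧ (∃ j ∈ T, i ≠ j ∧ OnStaircase p (f j) ∧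
      ∀ q ∈ E, StrictlyBelow q (f j) → (-g) p < (-g) q) ∧ (avoided f T p).card ≤ m}
  have hfinE := finite_verticesOn hfin hi hES
  refine (ncard_le_ncard ?_ (hfinE.subset ?_)).trans (hunion.trans (by omega))
  · rintro p ⟨hpE, ⟨j, hj, hij, hpj⟩, hpm⟩
    by_cases hr : ∀ q ∈ E, StrictlyBelow q (f j) → g p < g q
    · exact Or.inl ⟨hpE, ⟨j, hj, hij, hpj, hr⟩, hpm⟩
    refine Or.inr ⟨hpE, ⟨j, hj, hij, hpj, fun q hq hqs => ?_⟩, hpm⟩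
    push Not at hr
    obtain ⟨r, hr, hrs, hrp⟩ := hr
    by_contra hlt
    have hqp : g p ≤ g q := by simpa using hlt
    have hgg : ∃ a b : ℝ, 0 ≤ a ∧ 0 ≤ b ∧ a + b = 1 ∧ a * g r + b * g q = g p := by
      have : g p ∈ segment ℝ (g r) (g q) := by
        rw [segment_eq_Icc (hrp.trans hqp)]; exact ⟨hrp, hqp⟩
      simpa [segment] using this
    obtain ⟨a, b, ha, hb, hab, heq⟩ := hgg
    have hpeq : a • r + b • q = p := by
      apply hg (hE hr hq ha hb hab) hpE
      simpa using heq
    apply hpj.1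
    rw [← hpeq]
    rcases hb.eq_or_lt with rfl | hb
    · have : a = 1 := by linarith
      simpa [this] using hrs
    · exact hrs.weaklyBelow.combo_strictlyBelow hqs ha hb hab
  · rintro p (⟨hpE, ⟨j, hj, hij, hpj, _⟩, hpm⟩ | ⟨hpE, ⟨j, hj, hij, hpj, _⟩, hpm⟩) <;>
    exact ⟨hpE, ⟨j, hj, hij, hpj⟩, hpm⟩

/-- The largest abscissa on a segment. -/
def maxFst (s : Seg2) : ℝ := max s.1.1 s.2.1

/-- The largest ordinate on a segment. -/
def maxSnd (s : Seg2) : ℝ := max s.1.2 s.2.2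

section Edges

variable {s : Seg2} {p z : Pt2}

theorem fst_le_maxFst (hz : z ∈ segPts s) : z.1 ≤ maxFst s := by
  obtain ⟨a, b, ha, hb, hab, rfl⟩ := hz
  calc a * s.1.1 + b * s.2.1 ≤ a * maxFst s + b * maxFst s := by
        gcongr
        exacts [le_max_left _ _, le_max_right _ _]
    _ = maxFst s := by rw [← add_mul, hab, one_mul]

theorem snd_le_maxSnd (hz : z ∈ segPts s) : z.2 ≤ maxSnd s := by
  obtain ⟨a, b, ha, hb, hab, rfl⟩ := hz
  calc a * s.1.2 + b * s.2.2 ≤ a * maxSnd s + b * maxSnd s := by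
        gcongr
        exacts [le_max_left _ _, le_max_right _ _]
    _ = maxSnd s := by rw [← add_mul, hab, one_mul]

theorem StrictlyBelow.fst_lt (h : StrictlyBelow p s) : p.1 < maxFst s := by
  obtain ⟨z, hz, h1, -⟩ := h
  exact h1.trans_le (fst_le_maxFst hz)

theorem StrictlyBelow.snd_lt (h : StrictlyBelow p s) : p.2 < maxSnd s := by
  obtain ⟨z, hz, -, h2⟩ := h
  exact h2.trans_le (snd_le_maxSnd hz)

theorem exists_fst_eq_maxFst (s : Seg2) : ∃ z ∈ segPts s, z.1 = maxFst s := by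
  rcases max_choice s.1.1 s.2.1 with h | h
  · exact ⟨s.1, left_mem_segment _ _ _, h.symm⟩
  · exact ⟨s.2, right_mem_segment _ _ _, h.symm⟩

theorem exists_snd_eq_maxSnd (s : Seg2) : ∃ z ∈ segPts s, z.2 = maxSnd s := by
  rcases max_choice s.1.2 s.2.2 with h | h
  · exact ⟨s.1, left_mem_segment _ _ _, h.symm⟩
  · exact ⟨s.2, right_mem_segment _ _ _, h.symm⟩

/-- The vertical ray of the staircase of `s`. -/
def verticalEdge (s : Seg2) : Set Pt2 := {p | p.1 = maxFst s ∧ WeaklyBelow p s}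

/-- The horizontal ray of the staircase of `s`. -/
def horizontalEdge (s : Seg2) : Set Pt2 := {p | p.2 = maxSnd s ∧ WeaklyBelow p s}

/-- The part of the staircase of `s` that lies on `s` itself: all of `s` if the slope of `s` is
negative, and nothing otherwise. -/
def diagonalEdge (s : Seg2) : Set Pt2 :=
  {p | p ∈ segPts s ∧ ((s.1.1 < s.2.1 ∧ s.2.2 < s.1.2) ∨ (s.2.1 < s.1.1 ∧ s.1.2 < s.2.2))}

theorem convex_verticalEdge (s : Seg2) : Convex ℝ (verticalEdge s) := by
  rintro p ⟨hp, hp'⟩ q ⟨hq, hq'⟩ a b ha hb hab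
  refine ⟨?_, hp'.combo hq' ha hb hab⟩
  simp only [Prod.fst_add, Prod.smul_fst, smul_eq_mul, hp, hq]
  rw [← add_mul, hab, one_mul]

theorem convex_horizontalEdge (s : Seg2) : Convex ℝ (horizontalEdge s) := by
  rintro p ⟨hp, hp'⟩ q ⟨hq, hq'⟩ a b ha hb hab
  refine ⟨?_, hp'.combo hq' ha hb hab⟩
  simp only [Prod.snd_add, Prod.smul_snd, smul_eq_mul, hp, hq]
  rw [← add_mul, hab, one_mul]

theorem convex_diagonalEdge (s : Seg2) : Convex ℝ (diagonalEdge s) := by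
  rintro p ⟨hp, hp'⟩ q ⟨hq, -⟩ a b ha hb hab
  exact ⟨convex_segment _ _ hp hq ha hb hab, hp'⟩

theorem onStaircase_of_mem_verticalEdge (hp : p ∈ verticalEdge s) : OnStaircase p s :=
  ⟨fun h => h.fst_lt.ne hp.1, hp.2⟩

theorem onStaircase_of_mem_horizontalEdge (hp : p ∈ horizontalEdge s) : OnStaircase p s :=
  ⟨fun h => h.snd_lt.ne hp.1, hp.2⟩

theorem onStaircase_of_mem_diagonalEdge (hp : p ∈ diagonalEdge s) : OnStaircase p s := by
  obtain ⟨hps, hs⟩ := hp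
  refine ⟨?_, p, hps, le_rfl, le_rfl⟩
  rintro ⟨z, hz, h1, h2⟩
  rw [segPts, segment_eq_image'] at hz hps
  obtain ⟨a, -, rfl⟩ := hps
  obtain ⟨b, -, rfl⟩ := hz
  simp only [Prod.fst_add, Prod.snd_add, Prod.smul_fst, Prod.smul_snd, smul_eq_mul,
    Prod.fst_sub, Prod.snd_sub, add_lt_add_iff_left] at h1 h2
  rcases hs with ⟨h3, h4⟩ | ⟨h3, h4⟩
  · have := lt_of_mul_lt_mul_right h1 (by linarith)
    nlinarith
  · have := lt_of_mul_lt_mul_of_nonpos_right h1 (by linarith)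
    nlinarith

theorem injOn_snd_verticalEdge (s : Seg2) :
    InjOn (LinearMap.snd ℝ ℝ ℝ) (verticalEdge s) :=
  fun _ hp _ hq h => Prod.ext (hp.1.trans hq.1.symm) h

theorem injOn_fst_horizontalEdge (s : Seg2) :
    InjOn (LinearMap.fst ℝ ℝ ℝ) (horizontalEdge s) :=
  fun _ hp _ hq h => Prod.ext h (hp.1.trans hq.1.symm)

theorem injOn_fst_diagonalEdge (s : Seg2) :
    InjOn (LinearMap.fst ℝ ℝ ℝ) (diagonalEdge s) := by
  rintro p ⟨hp, hs⟩ q ⟨hq, -⟩ h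
  rw [segPts, segment_eq_image'] at hp hq
  obtain ⟨a, -, rfl⟩ := hp
  obtain ⟨b, -, rfl⟩ := hq
  have hne : s.2.1 - s.1.1 ≠ 0 := by
    rcases hs with ⟨h3, -⟩ | ⟨h3, -⟩
    · exact (sub_pos.2 h3).ne'
    · exact (sub_neg.2 h3).ne
  simp only [LinearMap.fst_apply, Prod.fst_add, Prod.smul_fst, smul_eq_mul, Prod.fst_sub,
    add_right_inj] at h
  rw [mul_right_cancel₀ hne h]

theorem exists_combo_pos {x y c : ℝ} (hx : c < x) :
    ∃ b : ℝ, 0 < b ∧ b ≤ 1 ∧ c < (1 - b) * x + b * y := by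
  rcases lt_or_ge c y with hy | hy
  · exact ⟨1, one_pos, le_rfl, by simpa using hy⟩
  · have hd : 0 < x - y := by linarith
    refine ⟨(x - c) / (2 * (x - y)), by apply div_pos <;> linarith, ?_, ?_⟩
    · rw [div_le_one (by linarith)]; linarith
    · have : (x - c) / (2 * (x - y)) * (x - y) = (x - c) / 2 := by field_simp
      linarith

theorem OnStaircase.mem_segPts (hp : OnStaircase p s) (h1 : p.1 < maxFst s)
    (h2 : p.2 < maxSnd s) : p ∈ segPts s := by
  obtain ⟨hns, z, hz, hz1, hz2⟩ := hp
  have e1 : p.1 = z.1 := by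
    by_contra hne
    obtain ⟨w, hw, hw2⟩ := exists_snd_eq_maxSnd s
    obtain ⟨b, hb, hb1, hbc⟩ := exists_combo_pos (y := w.1) (lt_of_le_of_ne hz1 hne)
    refine hns ⟨(1 - b) • z + b • w,
      convex_segment _ _ hz hw (by linarith) hb.le (by ring), hbc, ?_⟩
    simp only [Prod.snd_add, Prod.smul_snd, smul_eq_mul, hw2]
    nlinarith
  have e2 : p.2 = z.2 := by
    by_contra hne
    obtain ⟨w, hw, hw1⟩ := exists_fst_eq_maxFst s
    obtain ⟨b, hb, hb1, hbc⟩ := exists_combo_pos (y := w.2) (lt_of_le_of_ne hz2 hne)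
    refine hns ⟨(1 - b) • z + b • w,
      convex_segment _ _ hz hw (by linarith) hb.le (by ring), ?_, hbc⟩
    simp only [Prod.fst_add, Prod.smul_fst, smul_eq_mul, hw1]
    nlinarith
  rwa [show p = z from Prod.ext e1 e2]

theorem OnStaircase.mem_edge (hp : OnStaircase p s) :
    p ∈ verticalEdge s ∨ p ∈ horizontalEdge s ∨ p ∈ diagonalEdge s := by
  obtain ⟨y, hy, hy1, hy2⟩ := hp.2
  rcases (hy1.trans (fst_le_maxFst hy)).eq_or_lt with h1 | h1
  · exact Or.inl ⟨h1, hp.2⟩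
  rcases (hy2.trans (snd_le_maxSnd hy)).eq_or_lt with h2 | h2
  · exact Or.inr (Or.inl ⟨h2, hp.2⟩)
  have hps := hp.mem_segPts h1 h2
  refine Or.inr (Or.inr ⟨hps, ?_⟩)
  have hl : ¬ (p.1 < s.1.1 ∧ p.2 < s.1.2) := fun h => hp.1 ⟨s.1, left_mem_segment _ _ _, h⟩
  have hr : ¬ (p.1 < s.2.1 ∧ p.2 < s.2.2) := fun h => hp.1 ⟨s.2, right_mem_segment _ _ _, h⟩
  rcases lt_max_iff.1 h1 with h | h <;> rcases lt_max_iff.1 h2 with h' | h'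
  · exact absurd ⟨h, h'⟩ hl
  · right
    constructor
    · by_contra! hc; exact hr ⟨h.trans_le hc, h'⟩
    · by_contra! hc; exact hl ⟨h, h'.trans_le hc⟩
  · left
    constructor
    · by_contra! hc; exact hl ⟨h.trans_le hc, h'⟩
    · by_contra! hc; exact hr ⟨h, h'.trans_le hc⟩
  · exact absurd ⟨h, h'⟩ hr

end Edges

theorem ncard_le_of_subset_biUnion {α : Type*} {P : Set α} {A : Finset ι} {B : ι → Set α} {c : ℕ}
    (hP : P ⊆ ⋃ i ∈ A, B i) (hfin : ∀ i ∈ A, (B i).Finite) (hB : ∀ i ∈ A, (B i).ncard ≤ c) :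
    P.ncard ≤ A.card * c := by
  refine (ncard_le_ncard hP (A.finite_toSet.biUnion hfin)).trans
    ((Finset.set_ncard_biUnion_le A B).trans ?_)
  simpa using Finset.sum_le_card_nsmul _ _ _ hB

theorem ncard_shallowVertices_le (hfin : (shallowVertices f T m).Finite) :
    (shallowVertices f T m).ncard ≤ T.card * (6 * m) := by
  have hV : ∀ i ∈ T, _ := fun i hi => finite_verticesOn hfin hi
    (fun p => onStaircase_of_mem_verticalEdge (p := p) (s := f i))
  have hH : ∀ i ∈ T, _ := fun i hi => finite_verticesOn hfin hi
    (fun p => onStaircase_of_mem_horizontalEdge (p := p) (s := f i))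
  have hD : ∀ i ∈ T, _ := fun i hi => finite_verticesOn hfin hi
    (fun p => onStaircase_of_mem_diagonalEdge (p := p) (s := f i))
  refine ncard_le_of_subset_biUnion (B := fun i => verticesOn f T m i (verticalEdge (f i)) ∪
    (verticesOn f T m i (horizontalEdge (f i)) ∪ verticesOn f T m i (diagonalEdge (f i))))
    ?_ (fun i hi => (hV i hi).union ((hH i hi).union (hD i hi))) fun i hi => ?_
  · rintro p ⟨⟨i, hi, j, hj, hij, hpi, hpj⟩, hpm⟩
    simp only [mem_iUnion]
    refine ⟨i, hi, ?_⟩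
    rcases hpi.mem_edge with h | h | h
    · exact Or.inl ⟨h, ⟨j, hj, hij, hpj⟩, hpm⟩
    · exact Or.inr (Or.inl ⟨h, ⟨j, hj, hij, hpj⟩, hpm⟩)
    · exact Or.inr (Or.inr ⟨h, ⟨j, hj, hij, hpj⟩, hpm⟩)
  · have h1 := ncard_verticesOn_le hfin hi (convex_verticalEdge (f i))
      (fun p => onStaircase_of_mem_verticalEdge) _ (injOn_snd_verticalEdge (f i))
    have h2 := ncard_verticesOn_le hfin hi (convex_horizontalEdge (f i))
      (fun p => onStaircase_of_mem_horizontalEdge) _ (injOn_fst_horizontalEdge (f i))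
    have h3 := ncard_verticesOn_le hfin hi (convex_diagonalEdge (f i))
      (fun p => onStaircase_of_mem_diagonalEdge) _ (injOn_fst_diagonalEdge (f i))
    have h4 := ncard_union_le (verticesOn f T m i (verticalEdge (f i)))
      (verticesOn f T m i (horizontalEdge (f i)) ∪ verticesOn f T m i (diagonalEdge (f i)))
    have h5 := ncard_union_le (verticesOn f T m i (horizontalEdge (f i)))
      (verticesOn f T m i (diagonalEdge (f i)))
    omega

theorem card_low_rank_le (h : ι → ℝ) (T : Finset ι) (m : ℕ) :
    {i ∈ T | {j ∈ T | h j ≤ h i}.card ≤ m}.card ≤ m := by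
  set A := {i ∈ T | {j ∈ T | h j ≤ h i}.card ≤ m} with hA
  rcases A.eq_empty_or_nonempty with h0 | hne
  · simp [h0]
  obtain ⟨i, hi, hmax⟩ := A.exists_max_image h hne
  refine (Finset.card_le_card fun j hj => ?_).trans (Finset.mem_filter.1 hi).2
  exact Finset.mem_filter.2 ⟨(Finset.mem_filter.1 hj).1, hmax j hj⟩

theorem ncard_shallowVertices_le_of_disjoint (hfin : (shallowVertices f T m).Finite)
    (hdisj : ∀ i ∈ T, ∀ j ∈ T, i ≠ j → Disjoint (segPts (f i)) (segPts (f j))) :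
    (shallowVertices f T m).ncard ≤ 4 * m ^ 2 := by
  set A := {i ∈ T | {j ∈ T | maxFst (f j) ≤ maxFst (f i)}.card ≤ m} with hA
  set B := {i ∈ T | {j ∈ T | maxSnd (f j) ≤ maxSnd (f i)}.card ≤ m} with hB
  have hAT : ∀ i ∈ A, i ∈ T := fun i hi => (Finset.mem_filter.1 hi).1
  have hBT : ∀ i ∈ B, i ∈ T := fun i hi => (Finset.mem_filter.1 hi).1
  set V := ⋃ i ∈ A, verticesOn f T m i (verticalEdge (f i)) with hV
  set H := ⋃ i ∈ B, verticesOn f T m i (horizontalEdge (f i)) with hH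
  have hVfin : ∀ i ∈ A, (verticesOn f T m i (verticalEdge (f i))).Finite := fun i hi =>
    finite_verticesOn hfin (hAT i hi) (fun p => onStaircase_of_mem_verticalEdge)
  have hHfin : ∀ i ∈ B, (verticesOn f T m i (horizontalEdge (f i))).Finite := fun i hi =>
    finite_verticesOn hfin (hBT i hi) (fun p => onStaircase_of_mem_horizontalEdge)
  have hVcard : V.ncard ≤ A.card * (2 * m) := ncard_le_of_subset_biUnion subset_rfl hVfin
    fun i hi => ncard_verticesOn_le hfin (hAT i hi) (convex_verticalEdge (f i))
      (fun p => onStaircase_of_mem_verticalEdge) _ (injOn_snd_verticalEdge (f i))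
  have hHcard : H.ncard ≤ B.card * (2 * m) := ncard_le_of_subset_biUnion subset_rfl hHfin
    fun i hi => ncard_verticesOn_le hfin (hBT i hi) (convex_horizontalEdge (f i))
      (fun p => onStaircase_of_mem_horizontalEdge) _ (injOn_fst_horizontalEdge (f i))
  have hvert : ∀ i ∈ T, ∀ j ∈ T, i ≠ j → ∀ p ∈ verticalEdge (f i), OnStaircase p (f j) →
      (avoided f T p).card ≤ m → p ∈ V := by
    intro i hi j hj hij p hp hpj hpm
    simp only [hV, mem_iUnion]
    refine ⟨i, Finset.mem_filter.2 ⟨hi, (Finset.card_le_card fun l hl => ?_).trans hpm⟩,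
      hp, ⟨j, hj, hij, hpj⟩, hpm⟩
    obtain ⟨hl, hle⟩ := Finset.mem_filter.1 hl
    exact Finset.mem_filter.2 ⟨hl, fun h => (h.fst_lt.trans_le hle).ne hp.1⟩
  have hhor : ∀ i ∈ T, ∀ j ∈ T, i ≠ j → ∀ p ∈ horizontalEdge (f i), OnStaircase p (f j) →
      (avoided f T p).card ≤ m → p ∈ H := by
    intro i hi j hj hij p hp hpj hpm
    simp only [hH, mem_iUnion]
    refine ⟨i, Finset.mem_filter.2 ⟨hi, (Finset.card_le_card fun l hl => ?_).trans hpm⟩,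
      hp, ⟨j, hj, hij, hpj⟩, hpm⟩
    obtain ⟨hl, hle⟩ := Finset.mem_filter.1 hl
    exact Finset.mem_filter.2 ⟨hl, fun h => (h.snd_lt.trans_le hle).ne hp.1⟩
  have hsub : shallowVertices f T m ⊆ V ∪ H := by
    rintro p ⟨⟨i, hi, j, hj, hij, hpi, hpj⟩, hpm⟩
    rcases hpi.mem_edge with h | h | h
    · exact Or.inl (hvert i hi j hj hij p h hpj hpm)
    · exact Or.inr (hhor i hi j hj hij p h hpj hpm)
    rcases hpj.mem_edge with h' | h' | h'
    · exact Or.inl (hvert j hj i hi hij.symm p h' hpi hpm)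
    · exact Or.inr (hhor j hj i hi hij.symm p h' hpi hpm)
    · exact absurd h'.1 (disjoint_left.1 (hdisj i hi j hj hij) h.1)
  have hA' : A.card ≤ m := card_low_rank_le (fun i => maxFst (f i)) T m
  have hB' : B.card ≤ m := card_low_rank_le (fun i => maxSnd (f i)) T m
  calc (shallowVertices f T m).ncard ≤ (V ∪ H).ncard := ncard_le_ncard hsub
        ((A.finite_toSet.biUnion hVfin).union (B.finite_toSet.biUnion hHfin))
    _ ≤ V.ncard + H.ncard := ncard_union_le _ _
    _ ≤ m * (2 * m) + m * (2 * m) := by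
        gcongr
        · exact hVcard.trans (by gcongr)
        · exact hHcard.trans (by gcongr)
    _ = 4 * m ^ 2 := by ring

end Counting

section Reflections

/-- The map that multiplies the coordinates by `σ` and `τ`, a reflection for signs `σ` and `τ`. -/
def flipPt (σ τ : ℝ) : Pt2 →ₗ[ℝ] Pt2 :=
  LinearMap.prodMap (σ • LinearMap.id) (τ • LinearMap.id)

/-- The image of a segment under `flipPt`. -/
def flipSeg (σ τ : ℝ) (s : Seg2) : Seg2 := (flipPt σ τ s.1, flipPt σ τ s.2)

/-- The open quadrant whose image under `flipPt σ τ` is the upper right quadrant with corner `p`. -/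
def quadrant (σ τ : ℝ) (p : Pt2) : Set Pt2 := {z | p.1 < σ * z.1 ∧ p.2 < τ * z.2}

variable {σ τ : ℝ}

theorem segPts_flipSeg (σ τ : ℝ) (s : Seg2) : segPts (flipSeg σ τ s) = flipPt σ τ '' segPts s :=
  (image_segment ℝ (flipPt σ τ).toAffineMap s.1 s.2).symm

theorem flipPt_flipPt (hσ : σ = 1 ∨ σ = -1) (hτ : τ = 1 ∨ τ = -1) (p : Pt2) :
    flipPt σ τ (flipPt σ τ p) = p := by
  rcases hσ with rfl | rfl <;> rcases hτ with rfl | rfl <;> simp [flipPt]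

theorem disjoint_segPts_flipSeg (hσ : σ = 1 ∨ σ = -1) (hτ : τ = 1 ∨ τ = -1) {s t : Seg2}
    (h : Disjoint (segPts s) (segPts t)) :
    Disjoint (segPts (flipSeg σ τ s)) (segPts (flipSeg σ τ t)) := by
  rw [segPts_flipSeg, segPts_flipSeg]
  exact (disjoint_image_iff (Function.LeftInverse.injective (flipPt_flipPt hσ hτ))).2 h

theorem quadrant_inter_nonempty_iff (p : Pt2) (s : Seg2) :
    (quadrant σ τ p ∩ segPts s).Nonempty ↔ StrictlyBelow p (flipSeg σ τ s) := by
  simp only [StrictlyBelow, segPts_flipSeg, exists_mem_image, flipPt]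
  exact ⟨fun ⟨z, h, hz⟩ => ⟨z, hz, h⟩, fun ⟨z, hz, h⟩ => ⟨z, h, hz⟩⟩

theorem closure_quadrant (hσ : σ = 1 ∨ σ = -1) (hτ : τ = 1 ∨ τ = -1) (p : Pt2) :
    closure (quadrant σ τ p) = {z | p.1 ≤ σ * z.1 ∧ p.2 ≤ τ * z.2} := by
  have key : ∀ {ρ : ℝ}, (ρ = 1 ∨ ρ = -1) → ∀ c : ℝ,
      closure {x : ℝ | c < ρ * x} = {x | c ≤ ρ * x} := by
    rintro ρ (rfl | rfl) c
    · simp only [one_mul]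
      exact closure_Ioi c
    · simp only [neg_one_mul, lt_neg, le_neg]
      exact closure_Iio (-c)
  change closure ({x : ℝ | p.1 < σ * x} ×ˢ {y : ℝ | p.2 < τ * y}) = _
  rw [closure_prod_eq, key hσ, key hτ]
  rfl

theorem touches_quadrant_iff (hσ : σ = 1 ∨ σ = -1) (hτ : τ = 1 ∨ τ = -1) (p : Pt2) (s : Seg2) :
    Touches (quadrant σ τ p) s ↔ OnStaircase p (flipSeg σ τ s) := by
  rw [Touches, OnStaircase, ← quadrant_inter_nonempty_iff, not_nonempty_iff_eq_empty,
    closure_quadrant hσ hτ]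
  refine and_congr_right fun _ => ?_
  simp only [WeaklyBelow, segPts_flipSeg, exists_mem_image, flipPt]
  exact ⟨fun ⟨z, h, hz⟩ => ⟨z, hz, h⟩, fun ⟨z, hz, h⟩ => ⟨z, h, hz⟩⟩

theorem quadrant_injective (hσ : σ = 1 ∨ σ = -1) (hτ : τ = 1 ∨ τ = -1) :
    Function.Injective (quadrant σ τ) := by
  have key : ∀ p q : Pt2, quadrant σ τ p = quadrant σ τ q → q.1 ≤ p.1 ∧ q.2 ≤ p.2 := by
    intro p q h
    have hp : (σ * p.1, τ * p.2) ∈ closure (quadrant σ τ p) := by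
      rw [closure_quadrant hσ hτ]
      rcases hσ with rfl | rfl <;> rcases hτ with rfl | rfl <;> simp
    rw [h, closure_quadrant hσ hτ] at hp
    rcases hσ with rfl | rfl <;> rcases hτ with rfl | rfl <;> simpa using hp
  intro p q h
  have h1 := key p q h
  have h2 := key q p h.symm
  exact Prod.ext (le_antisymm h2.1 h1.1) (le_antisymm h2.2 h1.2)

theorem isOpenQuadrant_iff {Q : Set Pt2} :
    IsOpenQuadrant Q ↔ ∃ σ τ : ℝ, (σ = 1 ∨ σ = -1) ∧ (τ = 1 ∨ τ = -1) ∧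
      ∃ p, Q = quadrant σ τ p := by
  constructor
  · rintro ⟨a, b, rfl | rfl | rfl | rfl⟩
    · exact ⟨1, 1, by simp, by simp, (a, b), by simp [quadrant]⟩
    · exact ⟨1, -1, by simp, by simp, (a, -b), by simp [quadrant]⟩
    · exact ⟨-1, 1, by simp, by simp, (-a, b), by simp [quadrant]⟩
    · exact ⟨-1, -1, by simp, by simp, (-a, -b), by simp [quadrant]⟩
  · rintro ⟨σ, τ, rfl | rfl, rfl | rfl, p, rfl⟩
    · exact ⟨p.1, p.2, by simp [quadrant]⟩
    · exact ⟨p.1, -p.2, by simp [quadrant, lt_neg]⟩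
    · exact ⟨-p.1, p.2, by simp [quadrant, lt_neg]⟩
    · exact ⟨-p.1, -p.2, by simp [quadrant, lt_neg]⟩

variable {S : Finset Seg2} {n k : ℕ}

theorem quadrant_mem_suppQuadrants_iff (hσ : σ = 1 ∨ σ = -1) (hτ : τ = 1 ∨ τ = -1)
    (hS : S.card = n) (hk : 1 ≤ k) (hkn : k ≤ n) (p : Pt2) :
    quadrant σ τ p ∈ suppQuadrants S k ↔
      p ∈ shallowVertices (flipSeg σ τ) S (n + 1 - k) := by
  have hcount : {t ∈ (S : Set Seg2) | (quadrant σ τ p ∩ segPts t).Nonempty}.ncard +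
      (avoided (flipSeg σ τ) S p).card = n := by
    simp only [quadrant_inter_nonempty_iff, avoided]
    rw [← hS, ← Finset.card_filter_add_card_filter_not (s := S)
      (fun t => StrictlyBelow p (flipSeg σ τ t)), ← ncard_coe_finset {t ∈ S | StrictlyBelow p (flipSeg σ τ t)}, Finset.coe_filter]
    rfl
  simp only [suppQuadrants, shallowVertices, mem_ofPred_eq, touches_quadrant_iff hσ hτ]
  have hQ : IsOpenQuadrant (quadrant σ τ p) := isOpenQuadrant_iff.2 ⟨σ, τ, hσ, hτ, p, rfl⟩
  constructor
  · rintro ⟨-, h, hc⟩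
    exact ⟨h, by omega⟩
  · rintro ⟨h, hc⟩
    exact ⟨hQ, h, by omega⟩

theorem ncard_suppQuadrants_le (hS : S.card = n) (hk : 1 ≤ k) (hkn : k ≤ n)
    (hfin : (suppQuadrants S k).Finite) {c : ℕ}
    (hc : ∀ σ τ : ℝ, (σ = 1 ∨ σ = -1) → (τ = 1 ∨ τ = -1) →
      (shallowVertices (flipSeg σ τ) S (n + 1 - k)).Finite →
      (shallowVertices (flipSeg σ τ) S (n + 1 - k)).ncard ≤ c) :
    (suppQuadrants S k).ncard ≤ 4 * c := by
  set signs : Finset (ℝ × ℝ) := {1, -1} ×ˢ {1, -1} with hsigns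
  have hsgn : ∀ e ∈ signs, (e.1 = 1 ∨ e.1 = -1) ∧ (e.2 = 1 ∨ e.2 = -1) := by
    intro e he
    simpa [hsigns, Finset.mem_product] using he
  have hV : ∀ e ∈ signs, (shallowVertices (flipSeg e.1 e.2) S (n + 1 - k)).Finite := by
    intro e he
    obtain ⟨hσ, hτ⟩ := hsgn e he
    refine (hfin.preimage (quadrant_injective hσ hτ).injOn).subset fun p hp => ?_
    exact (quadrant_mem_suppQuadrants_iff hσ hτ hS hk hkn p).2 hp
  have hcard : signs.card ≤ 4 := by
    rw [hsigns, Finset.card_product]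
    exact Nat.mul_le_mul Finset.card_le_two Finset.card_le_two
  refine (ncard_le_of_subset_biUnion (A := signs) (c := c)
    (B := fun e => quadrant e.1 e.2 '' shallowVertices (flipSeg e.1 e.2) S (n + 1 - k))
    ?_ (fun e he => (hV e he).image _) fun e he => ?_).trans (by gcongr)
  · intro Q hQ
    obtain ⟨σ, τ, hσ, hτ, p, rfl⟩ := isOpenQuadrant_iff.1 hQ.1
    simp only [mem_iUnion]
    exact ⟨(σ, τ), by simpa [hsigns] using ⟨hσ, hτ⟩, p,
      (quadrant_mem_suppQuadrants_iff hσ hτ hS hk hkn p).1 hQ, rfl⟩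
  · obtain ⟨hσ, hτ⟩ := hsgn e he
    exact (ncard_image_le (hV e he)).trans (hc _ _ hσ hτ (hV e he))

end Reflections

/-- the number of supporting quadrants of pairs of distinct
segments of `S` intersecting at least `k - 1` segments of `S` is `O(n(n-k))` in
general, and `O((n-k)²)` if the segments are pairwise disjoint. -/
theorem supporting_quadrants_bound :
    ∃ C : ℝ, 0 < C ∧ ∀ n k : ℕ, ∀ S : Finset Seg2,
      S.card = n → Nondeg S → 1 ≤ k → k ≤ n - 1 →
      ((suppQuadrants S k).ncard : ℝ) ≤ C * n * ((n : ℝ) - k) ∧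
      (PwDisj S → ((suppQuadrants S k).ncard : ℝ) ≤ C * ((n : ℝ) - k) ^ 2) := by
  refine ⟨64, by norm_num, fun n k S hS _ hk hkn => ?_⟩
  rcases (suppQuadrants S k).finite_or_infinite with hfin | hinf
  · have hmk : ((n + 1 - k : ℕ) : ℝ) ≤ 2 * ((n : ℝ) - k) := by
      rw [Nat.cast_sub (by omega)]
      have : (k : ℝ) + 1 ≤ n := by exact_mod_cast (by omega : k + 1 ≤ n)
      push_cast
      linarith
    have hm0 : (0 : ℝ) ≤ ((n + 1 - k : ℕ) : ℝ) := Nat.cast_nonneg _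
    constructor
    · have h := ncard_suppQuadrants_le hS hk (by omega) hfin (c := n * (6 * (n + 1 - k)))
        fun σ τ hσ hτ hf => (ncard_shallowVertices_le hf).trans_eq (by rw [hS])
      have h' : ((suppQuadrants S k).ncard : ℝ) ≤ 4 * (n * (6 * ((n + 1 - k : ℕ) : ℝ))) := by
        exact_mod_cast h
      have := mul_le_mul_of_nonneg_left hmk (Nat.cast_nonneg (α := ℝ) n)
      have := mul_nonneg (Nat.cast_nonneg (α := ℝ) n) hm0
      nlinarith
    · intro hdisj
      have h := ncard_suppQuadrants_le hS hk (by omega) hfin (c := 4 * (n + 1 - k) ^ 2)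
        fun σ τ hσ hτ hf => ncard_shallowVertices_le_of_disjoint hf
          fun s hs t ht hst => disjoint_segPts_flipSeg hσ hτ (hdisj s hs t ht hst)
      have h' : ((suppQuadrants S k).ncard : ℝ) ≤ 4 * (4 * ((n + 1 - k : ℕ) : ℝ) ^ 2) := by
        exact_mod_cast h
      nlinarith
  · have hkn' : (0 : ℝ) ≤ (n : ℝ) - k := sub_nonneg.2 (by exact_mod_cast (by omega : k ≤ n))
    rw [hinf.ncard, Nat.cast_zero]
    exact ⟨by positivity, fun _ => by positivity⟩

end
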